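/- The operators R_i on V^{⊗n} induced by the Manin matrix R^{(r|s)} satisfy the defining relations of the Hecke algebra H_{n,q²}: (1) R_i R_j = R_j R_i whenever |i − j| ≥ 2; (2) R_i R_{i+1} R_i = R_{i+1} R_i R_{i+1} for 1 ≤ i ≤ n−2; (3) R_i² = (q² − 1) R_i + q²·id for all 1 ≤ i ≤ n−1. -/

import Mathlib

/-- Parity of a basis index: `0` for `i ≤ r` (even) and `1` for `i > r` (odd);
here indices are `0`-based, so index `i` is even iff `i < r`. -/
def maninParity (r s : ℕ) (i : Fin (r + s)) : ℕ := if (i : ℕ) < r then 0 else 1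

/-- Entries of Manin's matrix `R^{(r|s)}`:
`maninEntry q r s k l i j = R^{kl}_{ij}`, equal to `q²` if `i=j=k=l` with `i` even,
`−1` if `i=j=k=l` with `i` odd, `q²−1` if `k=i<j=l`, `(−1)^{ĩ·j̃}·q` if `k=j≠i=l`,
and `0` otherwise. -/
def maninEntry {K : Type*} [Field K] (q : K) (r s : ℕ) (k l i j : Fin (r + s)) : K :=
  if i = j ∧ j = k ∧ k = l then (if maninParity r s i = 0 then q ^ 2 else -1)
  else if k = i ∧ l = j ∧ i < j then q ^ 2 - 1
  else if k = j ∧ l = i ∧ i ≠ j then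
    (-1 : K) ^ (maninParity r s i * maninParity r s j) * q
  else 0

/-- The `n`-fold tensor power `V^{⊗n}` of the free module `V` with basis
`x_1, …, x_d`, realized as the free module with basis
`x_{f(0)} ⊗ x_{f(1)} ⊗ ⋯ ⊗ x_{f(n-1)}` indexed by functions `f : Fin n → Fin d`. -/
abbrev TensorPow (K : Type*) [Field K] (d n : ℕ) : Type _ := (Fin n → Fin d) → K

/-- The operator `R_i := id_V^{⊗ i} ⊗ R ⊗ id_V^{⊗ (n-i-2)}` on `V^{⊗n}` induced by
the Manin matrix `R^{(r|s)}` (with `0`-based position `i`, so it acts as `R` on the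
`i`-th and `(i+1)`-st tensor factors and as the identity elsewhere):
`R_i (x_{f(0)} ⊗ ⋯ ⊗ x_{f(n-1)}) =
  Σ_{a,b} R^{ab}_{f(i) f(i+1)} · x_{f(0)} ⊗ ⋯ ⊗ x_a ⊗ x_b ⊗ ⋯ ⊗ x_{f(n-1)}`. -/
noncomputable def maninRi (K : Type*) [Field K] (q : K) (r s : ℕ) (n : ℕ)
    (i : ℕ) (h : i + 1 < n) :
    TensorPow K (r + s) n →ₗ[K] TensorPow K (r + s) n :=
  (Pi.basisFun K (Fin n → Fin (r + s))).constr K fun f =>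
    ∑ a : Fin (r + s), ∑ b : Fin (r + s),
      maninEntry q r s a b (f ⟨i, by omega⟩) (f ⟨i + 1, h⟩) •
        Pi.basisFun K (Fin n → Fin (r + s))
          (Function.update (Function.update f ⟨i, by omega⟩ a) ⟨i + 1, h⟩ b)

/-- The coefficient of `x_i ⊗ x_j` in `R(x_i ⊗ x_j)`. -/
def maninDiag {K : Type*} [Field K] (q : K) (r s : ℕ) (i j : Fin (r + s)) : K :=
  if i = j then (if maninParity r s i = 0 then q ^ 2 else -1)
  else if i < j then q ^ 2 - 1 else 0

/-- The coefficient of `x_j ⊗ x_i` in `R(x_i ⊗ x_j)` for `i ≠ j`, and `0` for `i = j`. -/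
def maninSwap {K : Type*} [Field K] (q : K) (r s : ℕ) (i j : Fin (r + s)) : K :=
  if i = j then 0 else (-1 : K) ^ (maninParity r s i * maninParity r s j) * q

section Coefficients

variable {K : Type*} [Field K] (q : K) {r s : ℕ}

theorem maninEntry_eq_diag_add_swap (a b i j : Fin (r + s)) :
    maninEntry q r s a b i j =
      (if a = i then if b = j then maninDiag q r s i j else 0 else 0) +
        (if a = j then if b = i then maninSwap q r s i j else 0 else 0) := by
  unfold maninEntry maninDiag maninSwap
  grind

theorem sum_maninEntry_smul {M : Type*} [AddCommGroup M] [Module K M]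
    (F : Fin (r + s) → Fin (r + s) → M) (i j : Fin (r + s)) :
    ∑ a, ∑ b, maninEntry q r s a b i j • F a b =
      maninDiag q r s i j • F i j + maninSwap q r s i j • F j i := by
  simp [maninEntry_eq_diag_add_swap, add_smul, Finset.sum_add_distrib, ite_smul]

theorem maninDiag_self_sq (i : Fin (r + s)) :
    maninDiag q r s i i ^ 2 = (q ^ 2 - 1) * maninDiag q r s i i + q ^ 2 := by
  rw [maninDiag, if_pos rfl]
  split_ifs <;> ring

theorem maninDiag_of_lt {i j : Fin (r + s)} (h : i < j) : maninDiag q r s i j = q ^ 2 - 1 := by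
  simp [maninDiag, h, h.ne]

theorem maninDiag_of_gt {i j : Fin (r + s)} (h : j < i) : maninDiag q r s i j = 0 := by
  simp [maninDiag, h.ne', h.not_gt]

theorem maninSwap_self (i : Fin (r + s)) : maninSwap q r s i i = 0 := by
  simp [maninSwap]

theorem maninSwap_comm (i j : Fin (r + s)) : maninSwap q r s i j = maninSwap q r s j i := by
  simp [maninSwap, eq_comm, mul_comm (maninParity r s i)]

theorem maninSwap_sq {i j : Fin (r + s)} (h : i ≠ j) : maninSwap q r s i j ^ 2 = q ^ 2 := by
  rw [maninSwap, if_neg h, mul_pow, ← pow_mul, mul_comm _ 2, pow_mul]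
  simp

end Coefficients

section Abstract

variable {K : Type*} [Field K] {q : K} {r s : ℕ} {M : Type*} [AddCommGroup M] [Module K M]

theorem manin_quadratic_of_apply {A : M →ₗ[K] M} {L : Fin (r + s) → Fin (r + s) → M}
    (hA : ∀ x y, A (L x y) = maninDiag q r s x y • L x y + maninSwap q r s x y • L y x)
    (x y : Fin (r + s)) :
    A (A (L x y)) = (q ^ 2 - 1) • A (L x y) + q ^ 2 • L x y := by
  simp only [hA, map_add, map_smul]
  rcases lt_trichotomy x y with h | rfl | h
  · have := maninSwap_sq q h.ne
    simp only [maninDiag_of_lt q h, maninDiag_of_gt q h, maninSwap_comm q y x]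
    match_scalars <;> grind
  · have := maninDiag_self_sq q x
    simp only [maninSwap_self]
    match_scalars
    grind
  · have := maninSwap_sq q h.ne
    simp only [maninDiag_of_lt q h, maninDiag_of_gt q h, maninSwap_comm q x y]
    match_scalars <;> grind

theorem manin_braid_of_apply {A B : M →ₗ[K] M}
    {L : Fin (r + s) → Fin (r + s) → Fin (r + s) → M}
    (hA : ∀ x y z, A (L x y z) = maninDiag q r s x y • L x y z + maninSwap q r s x y • L y x z)
    (hB : ∀ x y z, B (L x y z) = maninDiag q r s y z • L x y z + maninSwap q r s y z • L x z y)
    (x y z : Fin (r + s)) :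
    A (B (A (L x y z))) = B (A (B (L x y z))) := by
  have hd := maninDiag_self_sq q (r := r) (s := s)
  have hs := fun x y : Fin (r + s) => maninSwap_sq q (i := x) (j := y)
  have hc := maninSwap_comm q (r := r) (s := s)
  have h0 := maninSwap_self q (r := r) (s := s)
  have hl := fun x y : Fin (r + s) => maninDiag_of_lt q (i := x) (j := y)
  have hg := fun x y : Fin (r + s) => maninDiag_of_gt q (i := x) (j := y)
  simp only [hA, hB, map_add, map_smul]
  by_cases hxy : x = y <;> by_cases hyz : y = z <;> by_cases hxz : x = z <;> subst_vars <;>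
    match_scalars <;> grind

theorem manin_commute_of_apply {A B : M →ₗ[K] M}
    {L : Fin (r + s) → Fin (r + s) → Fin (r + s) → Fin (r + s) → M}
    (hA : ∀ x y z w, A (L x y z w) =
      maninDiag q r s x y • L x y z w + maninSwap q r s x y • L y x z w)
    (hB : ∀ x y z w, B (L x y z w) =
      maninDiag q r s z w • L x y z w + maninSwap q r s z w • L x y w z)
    (x y z w : Fin (r + s)) :
    A (B (L x y z w)) = B (A (L x y z w)) := by
  simp only [hA, hB, map_add, map_smul]
  module

end Abstract

section Operators

variable (K : Type*) [Field K] (q : K) {r s n : ℕ}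

theorem maninRi_basisFun (i : ℕ) (h : i + 1 < n) (f : Fin n → Fin (r + s)) :
    maninRi K q r s n i h (Pi.basisFun K _ f) =
      maninDiag q r s (f ⟨i, by omega⟩) (f ⟨i + 1, h⟩) • Pi.basisFun K _ f +
        maninSwap q r s (f ⟨i, by omega⟩) (f ⟨i + 1, h⟩) •
          Pi.basisFun K _ (f ∘ Equiv.swap ⟨i, by omega⟩ ⟨i + 1, h⟩) := by
  rw [maninRi, Module.Basis.constr_basis, sum_maninEntry_smul]
  congr 3
  · simp
  · funext m
    simp only [Function.update_apply, Function.comp_apply, Equiv.swap_apply_def]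
    grind

theorem maninRi_comp_comm_of_add_two_le (i j : ℕ) (hi : i + 1 < n) (hj : j + 1 < n)
    (hij : i + 2 ≤ j) :
    maninRi K q r s n i hi ∘ₗ maninRi K q r s n j hj =
      maninRi K q r s n j hj ∘ₗ maninRi K q r s n i hi := by
  refine (Pi.basisFun K _).ext fun f => ?_
  let g (x y z w : Fin (r + s)) (m : Fin n) : Fin (r + s) :=
    if m.1 = i then x else if m.1 = i + 1 then y else
      if m.1 = j then z else if m.1 = j + 1 then w else f m
  have hf : f = g (f ⟨i, by omega⟩) (f ⟨i + 1, hi⟩) (f ⟨j, by omega⟩) (f ⟨j + 1, hj⟩) := by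
    funext m
    grind
  rw [hf]
  simp only [LinearMap.comp_apply]
  refine manin_commute_of_apply (q := q) (L := fun x y z w => Pi.basisFun K _ (g x y z w))
    (fun x y z w => ?_) (fun x y z w => ?_) _ _ _ _
  all_goals
    rw [maninRi_basisFun]
    congr 3
    all_goals grind (splits := 14)

theorem maninRi_braid (i : ℕ) (hi : i + 1 < n) (h : i + 2 < n) :
    maninRi K q r s n i hi ∘ₗ maninRi K q r s n (i + 1) h ∘ₗ
        maninRi K q r s n i hi =
      maninRi K q r s n (i + 1) h ∘ₗ maninRi K q r s n i hi ∘ₗ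
        maninRi K q r s n (i + 1) h := by
  refine (Pi.basisFun K _).ext fun f => ?_
  let g (x y z : Fin (r + s)) (m : Fin n) : Fin (r + s) :=
    if m.1 = i then x else if m.1 = i + 1 then y else if m.1 = i + 2 then z else f m
  have hf : f = g (f ⟨i, by omega⟩) (f ⟨i + 1, hi⟩) (f ⟨i + 2, h⟩) := by
    funext m
    grind
  rw [hf]
  simp only [LinearMap.comp_apply]
  refine manin_braid_of_apply (q := q) (L := fun x y z => Pi.basisFun K _ (g x y z))
    (fun x y z => ?_) (fun x y z => ?_) _ _ _
  all_goals
    rw [maninRi_basisFun]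
    congr 3
    all_goals grind (splits := 14)

theorem maninRi_quadratic (i : ℕ) (h : i + 1 < n) :
    maninRi K q r s n i h ∘ₗ maninRi K q r s n i h =
      (q ^ 2 - 1) • maninRi K q r s n i h + q ^ 2 • LinearMap.id := by
  refine (Pi.basisFun K _).ext fun f => ?_
  let g (x y : Fin (r + s)) (m : Fin n) : Fin (r + s) :=
    if m.1 = i then x else if m.1 = i + 1 then y else f m
  have hf : f = g (f ⟨i, by omega⟩) (f ⟨i + 1, h⟩) := by
    funext m
    grind
  rw [hf]
  simp only [LinearMap.comp_apply, LinearMap.add_apply, LinearMap.smul_apply, LinearMap.id_apply]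
  refine manin_quadratic_of_apply (q := q) (L := fun x y => Pi.basisFun K _ (g x y))
    (fun x y => ?_) _ _
  rw [maninRi_basisFun]
  congr 3
  all_goals grind (splits := 14)

end Operators

/-- The operators `R_i` on `V^{⊗n}` induced by the Manin matrix `R^{(r|s)}` satisfy
the defining relations of the Hecke algebra `H_{n,q²}`:
(1) `R_i R_j = R_j R_i` whenever `|i − j| ≥ 2`;
(2) `R_i R_{i+1} R_i = R_{i+1} R_i R_{i+1}`;
(3) `R_i² = (q² − 1) R_i + q²·id`.
(Positions are `0`-based: `R_i` acts on the `i`-th and `(i+1)`-st factors.) -/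
theorem manin_hecke_algebra_relations (K : Type*) [Field K] (q : K) (r s : ℕ) (n : ℕ) :
    (∀ (i j : ℕ) (hi : i + 1 < n) (hj : j + 1 < n), (i + 2 ≤ j ∨ j + 2 ≤ i) →
        maninRi K q r s n i hi ∘ₗ maninRi K q r s n j hj =
          maninRi K q r s n j hj ∘ₗ maninRi K q r s n i hi) ∧
    (∀ (i : ℕ) (h : i + 2 < n),
        maninRi K q r s n i (by omega) ∘ₗ maninRi K q r s n (i + 1) h ∘ₗ
            maninRi K q r s n i (by omega) =
          maninRi K q r s n (i + 1) h ∘ₗ maninRi K q r s n i (by omega) ∘ₗ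
            maninRi K q r s n (i + 1) h) ∧
    (∀ (i : ℕ) (h : i + 1 < n),
        maninRi K q r s n i h ∘ₗ maninRi K q r s n i h =
          (q ^ 2 - 1) • maninRi K q r s n i h + q ^ 2 • LinearMap.id) := by
  refine ⟨fun i j hi hj hij => ?_, fun i h => maninRi_braid K q i _ h, maninRi_quadratic K q⟩
  rcases hij with hij | hij
  · exact maninRi_comp_comm_of_add_two_le K q i j hi hj hij
  · exact (maninRi_comp_comm_of_add_two_le K q j i hj hi hij).symm
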